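/- Suppose F_τ(t) ∼ A t^m e^{-C/t} as t → 0⁺ with A > 0, C > 0, m ∈ ℝ, and σ is exponentially distributed with rate r independent of τ. Then P(τ < σ) ∼ A √π C^{(2m+1)/4} r^{(1-2m)/4} e^{-2√(Cr)} as r → ∞. -/

import Mathlib

open MeasureTheory ProbabilityTheory Real Filter Set Topology

lemma exists_rpow_le_mul_exp_add_inv (q : ℝ) {ε : ℝ} (hε : 0 < ε) :
    ∃ K : ℝ, 0 ≤ K ∧ ∀ x : ℝ, 0 < x → x ^ q ≤ K * exp (ε * (x + 1 / x)) := by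
  have key : ∀ p : ℝ, 0 ≤ p → ∀ x : ℝ, 0 < x →
      x ^ p ≤ (p / ε) ^ p * exp (ε * (x + 1 / x)) := by
    intro p hp x hx
    have hx' : 0 < 1 / x := by positivity
    have h := rpow_abs_le_mul_max_exp x hp hε.ne'
    rw [abs_of_pos hx, abs_of_pos hε] at h
    refine h.trans (mul_le_mul_of_nonneg_left (max_le ?_ ?_) (by positivity)) <;>
      refine exp_le_exp.2 ?_ <;> nlinarith [mul_pos hε hx, mul_pos hε hx']
  rcases le_total 0 q with hq | hq
  · exact ⟨_, by positivity, key q hq⟩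
  · have hq' : 0 ≤ -q := by linarith
    refine ⟨(-q / ε) ^ (-q), by positivity, fun x hx => ?_⟩
    have h := key (-q) hq' (1 / x) (by positivity)
    rw [one_div_one_div, add_comm, one_div, inv_rpow hx.le, rpow_neg hx.le, inv_inv] at h
    rwa [one_div]

/-- After rescaling around the saddle point `x = 1`, the Laplace integrand
`x ^ q * exp (-s ^ 2 * (x + 1 / x - 2))`, `x = 1 + v / s`, is dominated uniformly in `s ≥ 1`. -/
lemma exists_rpow_mul_exp_le_exp_neg_abs (q : ℝ) :
    ∃ K : ℝ, 0 ≤ K ∧ ∀ s : ℝ, 1 ≤ s → ∀ v : ℝ, 0 < 1 + v / s →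
      (1 + v / s) ^ q * exp (-v ^ 2 / (1 + v / s)) ≤ K * exp (-(1 / 2) * |v|) := by
  obtain ⟨K, hK, h⟩ := exists_rpow_le_mul_exp_add_inv q (ε := 3 / 8) (by norm_num)
  refine ⟨K * exp 1, by positivity, fun s hs v hx => ?_⟩
  have hs0 : 0 < s := by linarith
  obtain ⟨x, hxdef⟩ : ∃ x, x = 1 + v / s := ⟨_, rfl⟩
  rw [← hxdef] at hx ⊢
  have hv : v = s * (x - 1) := by rw [hxdef]; field_simp; ring
  have h₁ : x + 1 / x - 2 ≤ v ^ 2 / x := by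
    have : x + 1 / x - 2 = (x - 1) ^ 2 / x := by field_simp; ring
    rw [this, hv, mul_pow]
    gcongr
    nlinarith [sq_nonneg (x - 1), mul_nonneg (sub_nonneg.2 hs) (by linarith : (0 : ℝ) ≤ s + 1)]
  have h₂ : |v| - x / 4 ≤ v ^ 2 / x := by
    rw [le_div_iff₀ hx, ← sq_abs v]
    nlinarith [sq_nonneg (|v| - x / 2)]
  calc x ^ q * exp (-v ^ 2 / x)
      ≤ K * exp (3 / 8 * (x + 1 / x)) * exp (-v ^ 2 / x) := by gcongr; exact h x hx
    _ = K * exp (3 / 8 * (x + 1 / x) + -v ^ 2 / x) := by rw [exp_add]; ring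
    _ ≤ K * exp (1 + -(1 / 2) * |v|) := by
      refine mul_le_mul_of_nonneg_left (exp_le_exp.2 ?_) hK
      have : 0 < 1 / x := by positivity
      rw [neg_div]
      linarith
    _ = K * exp 1 * exp (-(1 / 2) * |v|) := by rw [exp_add]; ring

lemma integrable_exp_neg_mul_abs {b : ℝ} (hb : 0 < b) :
    Integrable (fun v : ℝ => exp (-b * |v|)) := by
  have h : IntegrableOn (fun v : ℝ => exp (-b * v)) (Ioi 0) :=
    integrableOn_exp_mul_Ioi (by linarith) 0
  have h' : IntegrableOn (fun v : ℝ => exp (b * v)) (Iic 0) :=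
    integrableOn_exp_mul_Iic hb 0
  rw [← integrableOn_univ, ← Iic_union_Ioi (a := (0 : ℝ))]
  refine IntegrableOn.union (h'.congr_fun (fun v hv => ?_) measurableSet_Iic)
    (h.congr_fun (fun v hv => ?_) measurableSet_Ioi)
  · simp [abs_of_nonpos (mem_Iic.1 hv)]
  · simp [abs_of_pos (mem_Ioi.1 hv)]

lemma tendsto_integral_rpow_mul_exp_mul {g : ℝ → ℝ} {m C K₁ K₂ p : ℝ} (hC : 0 < C)
    (hp : 0 ≤ p) (hK₁ : 0 ≤ K₁) (hK₂ : 0 ≤ K₂) (hg : Measurable g) (hg0 : ∀ t ≤ 0, g t = 0)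
    (hgK : ∀ t > 0, |g t| ≤ K₁ + K₂ * t ^ p) (hlim : Tendsto g (𝓝[>] 0) (𝓝 1)) :
    Tendsto (fun s : ℝ => ∫ v : ℝ, (1 + v / s) ^ m * exp (-v ^ 2 / (1 + v / s)) *
      g (C / s ^ 2 * (1 + v / s))) atTop (𝓝 (√π)) := by
  have hgauss : ∫ v : ℝ, exp (-v ^ 2) = √π := by simpa using integral_gaussian 1
  rw [← hgauss]
  obtain ⟨L₁, hL₁, h₁⟩ := exists_rpow_mul_exp_le_exp_neg_abs m
  obtain ⟨L₂, hL₂, h₂⟩ := exists_rpow_mul_exp_le_exp_neg_abs (m + p)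
  refine tendsto_integral_filter_of_dominated_convergence
    (fun v => (K₁ * L₁ + K₂ * L₂) * exp (-(1 / 2) * |v|)) ?_ ?_
    ((integrable_exp_neg_mul_abs (by norm_num)).const_mul _) ?_
  · exact Eventually.of_forall fun s => Measurable.aestronglyMeasurable (by fun_prop)
  · have hsC : ∀ᶠ s : ℝ in atTop, C ≤ s ^ 2 :=
      (tendsto_pow_atTop two_ne_zero).eventually_ge_atTop C
    filter_upwards [hsC, eventually_ge_atTop 1] with s hsC hs
    refine ae_of_all _ fun v => ?_
    have hs0 : 0 < s := by linarith
    rcases le_or_gt (1 + v / s) 0 with hx | hx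
    · rw [hg0 _ (mul_nonpos_of_nonneg_of_nonpos (by positivity) hx)]
      simp only [mul_zero, norm_zero]
      positivity
    · have e₁ := h₁ s hs v hx
      have e₂ := h₂ s hs v hx
      rw [rpow_add hx] at e₂
      generalize 1 + v / s = x at hx e₁ e₂ ⊢
      have hCs : C / s ^ 2 ≤ 1 := (div_le_one (by positivity)).2 hsC
      have e₃ : |g (C / s ^ 2 * x)| ≤ K₁ + K₂ * x ^ p := by
        refine (hgK _ (by positivity)).trans ?_
        gcongr
        exact mul_le_of_le_one_left hx.le hCs
      rw [norm_mul, Real.norm_of_nonneg (by positivity), Real.norm_eq_abs]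
      calc x ^ m * exp (-v ^ 2 / x) * |g (C / s ^ 2 * x)|
          ≤ x ^ m * exp (-v ^ 2 / x) * (K₁ + K₂ * x ^ p) := by gcongr
        _ = K₁ * (x ^ m * exp (-v ^ 2 / x)) + K₂ * (x ^ m * x ^ p * exp (-v ^ 2 / x)) := by ring
        _ ≤ K₁ * (L₁ * exp (-(1 / 2) * |v|)) + K₂ * (L₂ * exp (-(1 / 2) * |v|)) := by gcongr
        _ = _ := by ring
  · refine ae_of_all _ fun v => ?_
    have hx : Tendsto (fun s : ℝ => 1 + v / s) atTop (𝓝 1) := by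
      simpa using (tendsto_const_nhds (x := (1 : ℝ))).add
        (tendsto_const_nhds.div_atTop (tendsto_id (α := ℝ)) : Tendsto (fun s => v / s) _ (𝓝 0))
    have hc : Tendsto (fun s : ℝ => C / s ^ 2) atTop (𝓝 0) :=
      tendsto_const_nhds.div_atTop (tendsto_pow_atTop two_ne_zero)
    have harg : Tendsto (fun s : ℝ => C / s ^ 2 * (1 + v / s)) atTop (𝓝[>] 0) := by
      refine tendsto_nhdsWithin_iff.2 ⟨by simpa using hc.mul hx, ?_⟩
      filter_upwards [hx.eventually_const_lt one_pos, eventually_gt_atTop 0] with s h hs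
      exact mem_Ioi.2 (by positivity)
    have h := ((hx.rpow_const (p := m) (Or.inl one_ne_zero)).mul
      ((continuous_exp.tendsto _).comp
        ((tendsto_const_nhds (x := -v ^ 2)).div hx one_ne_zero))).mul (hlim.comp harg)
    simpa using h

lemma exists_bound_ratio {F : ℝ → ℝ} {A C m : ℝ} (hA : 0 < A) (hC : 0 < C)
    (hF0 : ∀ t, 0 ≤ F t) (hF1 : ∀ t, F t ≤ 1)
    (hF : Tendsto (fun t => F t / (A * t ^ m * exp (-C / t))) (𝓝[>] 0) (𝓝 1)) :
    ∃ K : ℝ, 0 ≤ K ∧ ∀ t > 0, |F t / (A * t ^ m * exp (-C / t))| ≤ 2 + K * t ^ |m| := by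
  obtain ⟨δ, hδ, h⟩ := mem_nhdsGT_iff_exists_Ioo_subset.1 (hF.eventually_lt_const one_lt_two)
  have hδ : 0 < δ := hδ
  refine ⟨exp (C / δ) / (A * δ ^ (|m| + m)), by positivity, fun t ht => ?_⟩
  rw [abs_of_nonneg (div_nonneg (hF0 t) (by positivity))]
  rcases lt_or_ge t δ with htδ | htδ
  · have : F t / (A * t ^ m * exp (-C / t)) < 2 := h ⟨ht, htδ⟩
    have : 0 ≤ exp (C / δ) / (A * δ ^ (|m| + m)) * t ^ |m| := by positivity
    linarith
  · have hk : δ ^ (|m| + m) ≤ t ^ |m| * t ^ m := by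
      rw [← rpow_add ht]
      exact rpow_le_rpow hδ.le htδ (by linarith [neg_abs_le m])
    have he : 1 ≤ exp (C / δ) * exp (-C / t) := by
      rw [← exp_add, neg_div]
      exact one_le_exp (sub_nonneg.2 (by gcongr))
    suffices F t / (A * t ^ m * exp (-C / t)) ≤ exp (C / δ) / (A * δ ^ (|m| + m)) * t ^ |m| by
      linarith
    rw [div_mul_eq_mul_div, div_le_div_iff₀ (by positivity) (by positivity)]
    calc F t * (A * δ ^ (|m| + m)) ≤ 1 * (A * (t ^ |m| * t ^ m)) := by
          gcongr
          exact hF1 t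
      _ ≤ exp (C / δ) * exp (-C / t) * (A * (t ^ |m| * t ^ m)) := by gcongr
      _ = _ := by ring

lemma integral_exp_mul_eq_rescaled {F : ℝ → ℝ} {A C m s : ℝ} (hA : 0 < A) (hC : 0 < C)
    (hs : 0 < s) (hF0 : ∀ t ≤ 0, F t = 0) :
    ∫ t, s ^ 4 / C * exp (-(s ^ 4 / C * t)) * F t =
      A * (C / s ^ 2) ^ m * s * exp (-(2 * s ^ 2)) *
        ∫ v : ℝ, (1 + v / s) ^ m * exp (-v ^ 2 / (1 + v / s)) *
          (F (C / s ^ 2 * (1 + v / s)) / (A * (C / s ^ 2 * (1 + v / s)) ^ m *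
            exp (-C / (C / s ^ 2 * (1 + v / s))))) := by
  set f : ℝ → ℝ := fun t => s ^ 4 / C * exp (-(s ^ 4 / C * t)) * F t with hf
  have hcv : ∫ t, f t = C / s ^ 3 * ∫ v, f (C / s ^ 2 + C / s ^ 3 * v) := by
    rw [Measure.integral_comp_mul_left (fun v => f (C / s ^ 2 + v)), integral_add_left_eq_self,
      abs_of_pos (by positivity), smul_eq_mul]
    field_simp
  rw [hcv, ← integral_const_mul, ← integral_const_mul]
  refine integral_congr_ae (ae_of_all _ fun v => ?_)
  have harg : C / s ^ 2 + C / s ^ 3 * v = C / s ^ 2 * (1 + v / s) := by field_simp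
  simp only [harg, hf]
  obtain ⟨x, hx⟩ : ∃ x, x = 1 + v / s := ⟨_, rfl⟩
  rw [← hx]
  have hv : v = s * (x - 1) := by rw [hx]; field_simp; ring
  rcases le_or_gt x 0 with h0 | h0
  · simp [hF0 _ (mul_nonpos_of_nonneg_of_nonpos (by positivity : 0 ≤ C / s ^ 2) h0)]
  · have hexp : exp (-(s ^ 4 / C * (C / s ^ 2 * x))) * exp (-C / (C / s ^ 2 * x)) =
        exp (-(2 * s ^ 2)) * exp (-v ^ 2 / x) := by
      rw [← exp_add, ← exp_add, hv]
      congr 1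
      field_simp
      ring
    rw [mul_rpow (by positivity) h0.le]
    have h₁ : 0 < (C / s ^ 2) ^ m := by positivity
    have h₂ : 0 < x ^ m := by positivity
    have h₃ : 0 < exp (-C / (C / s ^ 2 * x)) := exp_pos _
    generalize (C / s ^ 2) ^ m = a at *
    generalize x ^ m = b at *
    rw [mul_div_assoc', mul_div_assoc', eq_div_iff (by positivity)]
    generalize F (C / s ^ 2 * x) = y
    calc _ = s * (exp (-(s ^ 4 / C * (C / s ^ 2 * x))) * exp (-C / (C / s ^ 2 * x))) *
          (y * A * a * b) := by field_simp
      _ = _ := by rw [hexp]; ring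

/-- Laplace asymptotics of the Laplace–Stieltjes transform of a distribution function whose
behaviour near zero is `A * t ^ m * exp (-C / t)`. -/
lemma tendsto_laplace_div {F : ℝ → ℝ} {A C m : ℝ} (hA : 0 < A) (hC : 0 < C)
    (hmeas : Measurable F) (hF0 : ∀ t, 0 ≤ F t) (hF1 : ∀ t, F t ≤ 1) (hFneg : ∀ t ≤ 0, F t = 0)
    (hF : Tendsto (fun t => F t / (A * t ^ m * exp (-C / t))) (𝓝[>] 0) (𝓝 1)) :
    Tendsto (fun r : ℝ => (∫ t, r * exp (-(r * t)) * F t) /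
      (A * √π * C ^ ((2 * m + 1) / 4) * r ^ ((1 - 2 * m) / 4) * exp (-√(4 * C * r))))
      atTop (𝓝 1) := by
  obtain ⟨K, hK, hbound⟩ := exists_bound_ratio hA hC hF0 hF1 hF
  have hlim := (tendsto_integral_rpow_mul_exp_mul (m := m) hC (abs_nonneg m) zero_le_two hK
    (g := fun t => F t / (A * t ^ m * exp (-C / t))) (by fun_prop)
    (fun t ht => by simp [hFneg t ht]) hbound hF).div_const (√π)
  rw [div_self (by positivity)] at hlim
  have hs : Tendsto (fun r : ℝ => (C * r) ^ (1 / 4 : ℝ)) atTop atTop :=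
    (tendsto_rpow_atTop (by norm_num)).comp (tendsto_id.const_mul_atTop hC)
  refine (hlim.comp hs).congr' ?_
  filter_upwards [eventually_gt_atTop 0] with r hr
  have hCr : 0 < C * r := by positivity
  obtain ⟨s, hsdef⟩ : ∃ s, s = (C * r) ^ (1 / 4 : ℝ) := ⟨_, rfl⟩
  have hspos : 0 < s := by rw [hsdef]; positivity
  have hs4 : s ^ 4 = C * r := by
    rw [hsdef, ← rpow_natCast, ← rpow_mul hCr.le]; norm_num
  have hr4 : r = s ^ 4 / C := by rw [hs4]; field_simp
  have hsqrt : √(4 * C * r) = 2 * s ^ 2 := by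
    rw [show 4 * C * r = (2 * s ^ 2) ^ 2 by rw [mul_pow, ← pow_mul, hs4]; ring,
      sqrt_sq (by positivity)]
  have hpow : C ^ ((2 * m + 1) / 4) * r ^ ((1 - 2 * m) / 4) = (C / s ^ 2) ^ m * s := by
    have e₁ : (s ^ 4 : ℝ) ^ ((1 - 2 * m) / 4) = s ^ (1 - 2 * m) := by
      rw [← rpow_natCast, ← rpow_mul hspos.le]; congr 1; push_cast; ring
    have e₂ : (s ^ 2 : ℝ) ^ m = s ^ (2 * m) := by
      rw [← rpow_natCast, ← rpow_mul hspos.le]; norm_num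
    have e₃ : C ^ ((2 * m + 1) / 4) = C ^ m * C ^ ((1 - 2 * m) / 4) := by
      rw [← rpow_add hC]; congr 1; ring
    rw [hr4, div_rpow (by positivity) hC.le, div_rpow hC.le (by positivity), e₁, e₂, e₃,
      rpow_sub hspos, rpow_one]
    field_simp
  rw [Function.comp_apply, ← hsdef, hsqrt, mul_assoc (A * √π), hpow, hr4,
    integral_exp_mul_eq_rescaled (m := m) hA hC hspos hFneg]
  have h₁ : 0 < (C / s ^ 2) ^ m := by positivity
  rw [div_eq_div_iff (by positivity) (by positivity)]
  ring

lemma measureReal_lt_exponential_eq_integral {Ω : Type*} [MeasurableSpace Ω] {μ : Measure Ω}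
    [IsProbabilityMeasure μ] {X Y : Ω → ℝ} (hX : Measurable X) (hY : Measurable Y)
    (hXpos : ∀ᵐ ω ∂μ, 0 < X ω) {r : ℝ} (hr : 0 < r)
    (hdist : Measure.map Y μ = expMeasure r) (hindep : IndepFun X Y μ) :
    (μ {ω | X ω < Y ω}).toReal =
      ∫ t, r * exp (-(r * t)) * (μ {ω | X ω ≤ t}).toReal := by
  have hprob := isProbabilityMeasure_expMeasure hr
  have hprobX := Measure.isProbabilityMeasure_map (μ := μ) hX.aemeasurable
  have hprod := (indepFun_iff_map_prod_eq_prod_map_map hX.aemeasurable hY.aemeasurable).1 hindep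
  have hS : MeasurableSet {p : ℝ × ℝ | p.1 < p.2} := measurableSet_lt measurable_fst measurable_snd
  have hmeas : Measurable fun t => μ {ω | X ω < t} :=
    Monotone.measurable fun a b hab => measure_mono fun ω hω => lt_of_lt_of_le hω hab
  have h₁ : μ {ω | X ω < Y ω} = ∫⁻ t, μ {ω | X ω < t} ∂(expMeasure r) := by
    have : μ {ω | X ω < Y ω} = Measure.map (fun ω => (X ω, Y ω)) μ {p : ℝ × ℝ | p.1 < p.2} :=
      (Measure.map_apply (hX.prodMk hY) hS).symm
    rw [this, hprod, Measure.prod_apply_symm hS, hdist]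
    refine lintegral_congr fun t => ?_
    rw [Measure.map_apply hX (measurable_prodMk_right hS)]
    rfl
  have h₂ : (μ {ω | X ω < Y ω}).toReal = ∫ t, (μ {ω | X ω < t}).toReal ∂(expMeasure r) := by
    rw [h₁, integral_toReal hmeas.aemeasurable (ae_of_all _ fun t => measure_lt_top _ _)]
  have hlt : ∀ᵐ t : ℝ, μ {ω | X ω ≤ t} = μ {ω | X ω < t} := by
    have hcount : {t : ℝ | μ {ω | X ω ≤ t} ≠ μ {ω | X ω < t}}.Countable :=
      countable_meas_le_ne_meas_lt (R := ℝᵒᵈ) μ fun ω => OrderDual.toDual (X ω)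
    exact hcount.measure_zero volume
  have hpdf : Measurable (gammaPDF 1 r) := (measurable_gammaPDFReal 1 r).ennreal_ofReal
  rw [h₂, expMeasure, gammaMeasure, integral_withDensity_eq_integral_toReal_smul hpdf
    (ae_of_all _ fun t => ENNReal.ofReal_lt_top)]
  refine integral_congr_ae ?_
  filter_upwards [hlt] with t ht
  change (exponentialPDF r t).toReal • _ = _
  rw [ht, exponentialPDF_eq, smul_eq_mul]
  split_ifs with h0
  · rw [ENNReal.toReal_ofReal (by positivity)]
  · have : μ {ω | X ω < t} = 0 := by
      refine measure_eq_zero_iff_ae_notMem.2 ?_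
      filter_upwards [hXpos] with ω hω h
      exact h0 (hω.trans h).le
    simp [this]

/-- If `F_τ(t) ∼ A t^m e^{-C/t}` as `t → 0⁺` and `σ_r` is exponential with rate `r`,
independent of `τ`, then `P(τ < σ_r) ∼ A √π C^{(2m+1)/4} r^{(1-2m)/4} e^{-√(4Cr)}`
as `r → ∞`. -/
theorem prob_fast_exponential_asymptotic
    {Ω : Type*} [MeasurableSpace Ω] (μ : Measure Ω) [IsProbabilityMeasure μ]
    (τ : Ω → ℝ) (σ : ℝ → Ω → ℝ)
    (hτ : Measurable τ) (hσ : ∀ r, Measurable (σ r))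
    (hτpos : ∀ᵐ ω ∂μ, 0 < τ ω)
    (A C m : ℝ) (hA : 0 < A) (hC : 0 < C)
    (hdist : ∀ r > 0, Measure.map (σ r) μ = expMeasure r)
    (hindep : ∀ r > 0, IndepFun τ (σ r) μ)
    (hF : Tendsto (fun t => (μ {ω | τ ω ≤ t}).toReal /
        (A * t ^ m * Real.exp (-C / t))) (𝓝[>] 0) (𝓝 1)) :
    Tendsto (fun r : ℝ =>
        (μ {ω | τ ω < σ r ω}).toReal /
          (A * Real.sqrt π * C ^ ((2 * m + 1) / 4) * r ^ ((1 - 2 * m) / 4) *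
            Real.exp (-Real.sqrt (4 * C * r))))
      atTop (𝓝 1) := by
  have hzero : ∀ t ≤ 0, (μ {ω | τ ω ≤ t}).toReal = 0 := by
    intro t ht
    have : μ {ω | τ ω ≤ t} = 0 := by
      refine measure_eq_zero_iff_ae_notMem.2 ?_
      filter_upwards [hτpos] with ω hω h
      exact absurd (hω.trans_le (h.trans ht)) (lt_irrefl 0)
    simp [this]
  have hmono : Monotone fun t => (μ {ω | τ ω ≤ t}).toReal := fun a b hab =>
    measureReal_mono fun ω hω => le_trans hω hab
  refine (tendsto_laplace_div hA hC hmono.measurable (fun t => ENNReal.toReal_nonneg)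
    (fun t => measureReal_le_one) hzero hF).congr' ?_
  filter_upwards [eventually_gt_atTop 0] with r hr
  rw [measureReal_lt_exponential_eq_integral hτ (hσ r) hτpos hr (hdist r hr) (hindep r hr)]
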